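/- Let X be an infinite compact Hausdorff space and G a group acting faithfully on X by homeomorphisms. Let 𝓘 be a basis for the topology of X consisting of nonempty open sets that are not dense in X, and suppose conditions (C), (2T), (3T) and (L) hold for (G, X, 𝓘). Let 𝓐 ⊆ 𝓘 be a finite cover of X such that for every I, J ∈ 𝓐 there exists K ∈ 𝓐 with closure(K) ∩ (closure(I) ∪ closure(J)) = ∅. Set A := {g ∈ G : there exists I ∈ 𝓐 with g•x = x for all x ∈ I} and B := {g ∈ G : there exists I ∈ 𝓘 with g•x = x for all x ∈ I}. Then there exists an integer r ≥ 1 such that for all g, h ∈ G there exist b, b₁, …, b_r ∈ B with the following property: for every a ∈ A there exist integers m₁, …, m_r such that, setting f := b₁^{m₁} · b₂^{m₂} ⋯ b_r^{m_r}, each of the three elements (f a f⁻¹)·b, (f a f⁻¹)·b·g and (f a f⁻¹)·b·h belongs to B. -/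

import Mathlib

/-- An action of `G` on `X` by homeomorphisms. -/
def IsActionByHomeos (G : Type*) [Group G] (X : Type*) [TopologicalSpace X]
    (a : G → X → X) : Prop :=
  (∀ x, a 1 x = x) ∧ (∀ g h x, a (g * h) x = a g (a h x)) ∧
    (∀ g : G, Continuous (a g))

/-- The action is faithful. -/
def FaithfulAction (G : Type*) [Group G] (X : Type*) (a : G → X → X) : Prop :=
  ∀ g : G, (∀ x, a g x = x) → g = 1

/-- `(I, J) ∈ 𝓘⁽²⁾`: a pair of members of `𝓘` with disjoint closures whose
union is not dense. -/
def Tup2 {X : Type*} [TopologicalSpace X] (𝓘 : Set (Set X))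
    (I J : Set X) : Prop :=
  I ∈ 𝓘 ∧ J ∈ 𝓘 ∧ Disjoint (closure I) (closure J) ∧ ¬ Dense (I ∪ J)

/-- `(I, J, K) ∈ 𝓘⁽³⁾`: a triple of members of `𝓘` with pairwise disjoint
closures whose union is not dense. -/
def Tup3 {X : Type*} [TopologicalSpace X] (𝓘 : Set (Set X))
    (I J K : Set X) : Prop :=
  I ∈ 𝓘 ∧ J ∈ 𝓘 ∧ K ∈ 𝓘 ∧ Disjoint (closure I) (closure J) ∧
    Disjoint (closure I) (closure K) ∧ Disjoint (closure J) (closure K) ∧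
    ¬ Dense (I ∪ J ∪ K)

/-- Condition (C): every member of `𝓘` has its complement contained in a
member of `𝓘`. -/
def CondC {X : Type*} (𝓘 : Set (Set X)) : Prop :=
  ∀ I ∈ 𝓘, ∃ J ∈ 𝓘, Iᶜ ⊆ J

/-- Condition (2T): `G` preserves `𝓘` and acts doubly transitively on it. -/
def Cond2T {G X : Type*} [Group G] [TopologicalSpace X] (a : G → X → X)
    (𝓘 : Set (Set X)) : Prop :=
  (∀ g : G, ∀ I ∈ 𝓘, a g '' I ∈ 𝓘) ∧
    ∀ I J I' J' : Set X, Tup2 𝓘 I J → Tup2 𝓘 I' J' →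
      ∃ g : G, a g '' I = I' ∧ a g '' J = J'

/-- Condition (3T): weak triple transitivity. -/
def Cond3T {G X : Type*} [Group G] [TopologicalSpace X] (a : G → X → X)
    (𝓘 : Set (Set X)) : Prop :=
  ∀ g h : G, ∃ M N P : Set X, Tup3 𝓘 M N P ∧
    ∃ b : G, a b '' (a g '' M) = M ∧ a b '' (a h '' N) = N ∧ a b '' P = P

/-- Condition (L): local actions on disjoint members of `𝓘` can be combined. -/
def CondL {G X : Type*} [Group G] [TopologicalSpace X] (a : G → X → X)
    (𝓘 : Set (Set X)) : Prop :=
  ∀ I J K : Set X, Tup3 𝓘 I J K → ∀ g h : G, a g '' I = I → a h '' J = J →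
    ∃ b : G, (∀ x ∈ I, a b x = a g x) ∧ (∀ x ∈ J, a b x = a h x) ∧
      (∀ x ∈ K, a b x = x)

/-- `WordIn l f`: `f` is a product of powers of the entries of `l`, in order. -/
def WordIn {G : Type*} [Group G] : List G → G → Prop
  | [], f => f = 1
  | x :: l, f => ∃ (m : ℤ) (f' : G), WordIn l f' ∧ f = x ^ m * f'

theorem wordIn_one {G : Type*} [Group G] (l : List G) : WordIn l 1 := by
  induction l with
  | nil => rfl
  | cons x l ih => exact ⟨0, 1, ih, by simp⟩

theorem wordIn_prod {G : Type*} [Group G] (l : List G) : WordIn l l.prod := by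
  induction l with
  | nil => rfl
  | cons x l ih => exact ⟨1, _, ih, by simp⟩

theorem wordIn_append {G : Type*} [Group G] (l l' : List G) (f f' : G)
    (h : WordIn l f) (h' : WordIn l' f') : WordIn (l ++ l') (f * f') := by
  induction l generalizing f with
  | nil =>
    have h1 : f = 1 := h
    simpa [h1] using h'
  | cons x l ih =>
    obtain ⟨m, k, hk, rfl⟩ := h
    exact ⟨m, k * f', ih k hk, by rw [mul_assoc]⟩

theorem wordIn_ofFn {G : Type*} [Group G] (r : ℕ) (bs : Fin r → G) (f : G)
    (h : WordIn (List.ofFn bs) f) :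
    ∃ ms : Fin r → ℤ, f = (List.ofFn fun i : Fin r => bs i ^ ms i).prod := by
  induction r generalizing f with
  | zero => exact ⟨fun _ => 0, by simpa [WordIn] using h⟩
  | succ r ih =>
    rw [List.ofFn_succ] at h
    obtain ⟨m, k, hk, rfl⟩ := h
    obtain ⟨ms, rfl⟩ := ih _ _ hk
    exact ⟨Fin.cons m ms, by simp [List.ofFn_succ]⟩

theorem word_family {G S : Type*} [Group G] (B : Set G)
    (hB : ∀ g : G, ∃ l : List G, l.length = 4 ∧ (∀ x ∈ l, x ∈ B) ∧ g = l.prod)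
    (F : S → G) (T : Finset S) :
    ∃ l : List G, l.length = 4 * T.card ∧ (∀ x ∈ l, x ∈ B) ∧ ∀ I ∈ T, WordIn l (F I) := by
  classical
  induction T using Finset.induction_on with
  | empty => exact ⟨[], by simp, by simp, by simp⟩
  | insert I T hI ih =>
    obtain ⟨l, hl, hlB, hlF⟩ := ih
    obtain ⟨k, hk, hkB, hkF⟩ := hB (F I)
    refine ⟨k ++ l, ?_, ?_, ?_⟩
    · rw [List.length_append, hl, hk, Finset.card_insert_of_notMem hI]; ring
    · intro x hx
      rcases List.mem_append.1 hx with h | h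
      · exact hkB x h
      · exact hlB x h
    · intro J hJ
      rcases Finset.mem_insert.1 hJ with rfl | h
      · have := wordIn_append k l _ _ (wordIn_prod k) (wordIn_one l)
        rwa [mul_one, ← hkF] at this
      · have := wordIn_append k l _ _ (wordIn_one k) (hlF J h)
        rwa [one_mul] at this

theorem no_isolated {G X : Type*} [Group G] [TopologicalSpace X]
    [CompactSpace X] [T2Space X] [Infinite X] (a : G → X → X)
    (𝓘 : Set (Set X)) (hbasis : TopologicalSpace.IsTopologicalBasis 𝓘)
    (h2T : Cond2T a 𝓘) (u : X) : ¬ IsOpen ({u} : Set X) := by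
  intro hu
  have hy : ∃ y : X, ¬ IsOpen ({y} : Set X) := by
    by_contra! hc
    have : DiscreteTopology X := discreteTopology_iff_isOpen_singleton.2 hc
    exact not_finite_iff_infinite.2 ‹Infinite X› finite_of_compact_of_discrete
  obtain ⟨y, hy⟩ := hy
  have huy : y ≠ u := by rintro rfl; exact hy hu
  obtain ⟨z, hz⟩ := (Set.toFinite ({u, y} : Set X)).infinite_compl.nonempty
  simp only [Set.mem_compl_iff, Set.mem_insert_iff, Set.mem_singleton_iff, not_or] at hz
  have huI : ({u} : Set X) ∈ 𝓘 := by
    obtain ⟨t, ht, hut, hts⟩ := hbasis.exists_subset_of_mem_open (Set.mem_singleton u) hu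
    have : t = {u} := Set.Subset.antisymm hts (by simpa using hut)
    rwa [this] at ht
  have hop : IsOpen (({u, z} : Set X)ᶜ) := (Set.toFinite _).isClosed.isOpen_compl
  obtain ⟨K, hK, hyK, hKs⟩ := hbasis.exists_closure_subset
    (hop.mem_nhds (show y ∈ ({u, z} : Set X)ᶜ by simp [huy, Ne.symm hz.2]))
  have huK : u ∉ closure K := fun h => hKs h (by simp)
  have hzK : z ∉ closure K := fun h => hKs h (by simp)
  have hdisj : Disjoint (closure ({u} : Set X)) (closure K) := by
    rw [closure_singleton]; exact Set.disjoint_singleton_left.2 huK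
  have hnd : ¬ Dense ({u} ∪ K) := by
    intro hd
    have := hd z
    rw [closure_union, closure_singleton] at this
    rcases this with h | h
    · exact hz.1 h
    · exact hzK h
  obtain ⟨g, hg, -⟩ := h2T.2 {u} K K {u} ⟨huI, hK, hdisj, hnd⟩
    ⟨hK, huI, hdisj.symm, by rwa [Set.union_comm]⟩
  rw [Set.image_singleton] at hg
  have hyg : y = a g u := by rw [← hg] at hyK; exact hyK
  apply hy
  rw [hyg, hg]
  exact hbasis.isOpen hK

theorem exists_tup2 {G X : Type*} [Group G] [TopologicalSpace X]
    [CompactSpace X] [T2Space X] [Infinite X] (a : G → X → X)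
    (𝓘 : Set (Set X)) (hbasis : TopologicalSpace.IsTopologicalBasis 𝓘)
    (hnd : ∀ I ∈ 𝓘, ¬ Dense I)
    (h2T : Cond2T a 𝓘) (I : Set X) (hI : I ∈ 𝓘) : ∃ K, Tup2 𝓘 I K := by
  have h1 : ∃ u, u ∉ closure I := by
    by_contra! hc
    exact hnd I hI hc
  obtain ⟨u, hu⟩ := h1
  have h2 : ∃ v, v ∉ closure I ∧ v ≠ u := by
    by_contra! hc
    apply no_isolated a 𝓘 hbasis h2T u
    have : ({u} : Set X) = (closure I)ᶜ := by
      ext w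
      constructor
      · rintro rfl; exact hu
      · intro hw; exact hc w hw
    rw [this]
    exact isClosed_closure.isOpen_compl
  obtain ⟨v, hv, hvu⟩ := h2
  have hop : IsOpen ((closure I ∪ {v})ᶜ) :=
    (isClosed_closure.union isClosed_singleton).isOpen_compl
  obtain ⟨K, hK, huK, hKs⟩ := hbasis.exists_closure_subset
    (hop.mem_nhds (show u ∈ (closure I ∪ {v})ᶜ by simp [hu, Ne.symm hvu]))
  refine ⟨K, hI, hK, ?_, ?_⟩
  · exact Set.disjoint_left.2 fun w hw hw' => hKs hw' (Or.inl hw)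
  · intro hd
    have := hd v
    rw [closure_union] at this
    rcases this with h | h
    · exact hv h
    · exact hKs h (Or.inr rfl)

theorem four_factors {G X : Type*} [Group G] [TopologicalSpace X]
    (a : G → X → X) (hact : IsActionByHomeos G X a)
    (𝓘 : Set (Set X)) (h3T : Cond3T a 𝓘) (hL : CondL a 𝓘) (B : Set G)
    (hB : B = {g : G | ∃ I ∈ 𝓘, ∀ x ∈ I, a g x = x}) (g : G) :
    ∃ l : List G, l.length = 4 ∧ (∀ x ∈ l, x ∈ B) ∧ g = l.prod := by
  obtain ⟨h1, hm, -⟩ := hact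
  have hinv : ∀ c : G, ∀ x, a c⁻¹ (a c x) = x := fun c x => by
    rw [← hm, inv_mul_cancel, h1]
  have hBinv : ∀ c ∈ B, c⁻¹ ∈ B := by
    subst hB
    rintro c ⟨I, hI, hc⟩
    refine ⟨I, hI, fun x hx => ?_⟩
    conv_lhs => rw [← hc x hx]
    exact hinv c x
  have h1im : ∀ S : Set X, a 1 '' S = S := fun S => by
    ext x; simp [h1]
  obtain ⟨M, N, P, ⟨hM, hN, hP, hMN, hMP, hNP, hd⟩, b, hbM, -, hbP⟩ := h3T g 1
  obtain ⟨c, hcM, -, hcP⟩ := hL M N P ⟨hM, hN, hP, hMN, hMP, hNP, hd⟩ (b * g) 1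
    (by rw [← hbM]; conv_rhs => rw [← hbM]
        rw [hbM, Set.image_image]; simp only [hm]) (h1im N)
  obtain ⟨d, hdP, hdM, -⟩ := hL P M N ⟨hP, hM, hN, hMP.symm, hNP.symm, hMN, by
    rwa [Set.union_assoc, Set.union_comm P]⟩ b 1 hbP (h1im M)
  have hcB : c ∈ B := by rw [hB]; exact ⟨P, hP, hcP⟩
  have hdB : d ∈ B := by
    rw [hB]; exact ⟨M, hM, fun x hx => by rw [hdM x hx, h1]⟩
  have hk : c⁻¹ * (b * g) ∈ B := by
    rw [hB]; exact ⟨M, hM, fun x hx => by rw [hm, ← hcM x hx, hinv]⟩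
  have he : d⁻¹ * b ∈ B := by
    rw [hB]; exact ⟨P, hP, fun x hx => by rw [hm, ← hdP x hx, hinv]⟩
  refine ⟨[(d⁻¹ * b)⁻¹, d⁻¹, c, c⁻¹ * (b * g)], rfl, ?_, ?_⟩
  · intro x hx
    simp only [List.mem_cons, List.not_mem_nil, or_false] at hx
    rcases hx with rfl | rfl | rfl | rfl
    · exact hBinv _ he
    · exact hBinv _ hdB
    · exact hcB
    · exact hk
  · simp only [List.prod_cons, List.prod_nil]; group

theorem exists_b {G X : Type*} [Group G] [TopologicalSpace X]
    (a : G → X → X) (hact : IsActionByHomeos G X a)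
    (𝓘 : Set (Set X)) (h3T : Cond3T a 𝓘) (hL : CondL a 𝓘) (g h : G) :
    ∃ b : G, ∃ M ∈ 𝓘, ∃ N ∈ 𝓘, ∃ P ∈ 𝓘, (∀ x ∈ P, a b x = x) ∧
      (∀ x ∈ M, a (b * g) x = x) ∧ (∀ x ∈ N, a (b * h) x = x) := by
  obtain ⟨h1, hm, -⟩ := hact
  have hinv : ∀ c : G, ∀ x, a c⁻¹ (a c x) = x := fun c x => by
    rw [← hm, inv_mul_cancel, h1]
  have h1im : ∀ S : Set X, a 1 '' S = S := fun S => by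
    ext x; simp [h1]
  have hsinv : ∀ (c : G) (S : Set X), a c '' S = S → a c⁻¹ '' S = S := by
    intro c S hS
    conv_lhs => rw [← hS]
    rw [Set.image_image]; simp [hinv]
  have himm : ∀ (c d : G) (S : Set X), a c '' (a d '' S) = a (c * d) '' S := by
    intro c d S; rw [Set.image_image]; simp only [hm]
  obtain ⟨M, N, P, ⟨hM, hN, hP, hMN, hMP, hNP, hd⟩, b, hbM, hbN, hbP⟩ := h3T g h
  rw [himm] at hbM hbN
  obtain ⟨c, hcM, hcN, hcP⟩ := hL M N P ⟨hM, hN, hP, hMN, hMP, hNP, hd⟩ (b * g)⁻¹ (b * h)⁻¹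
    (hsinv _ _ hbM) (hsinv _ _ hbN)
  obtain ⟨d, hdP, hdM, hdN⟩ := hL P M N ⟨hP, hM, hN, hMP.symm, hNP.symm, hMN, by
    rwa [Set.union_assoc, Set.union_comm P]⟩ b⁻¹ 1 (hsinv _ _ hbP) (h1im M)
  refine ⟨d * c * b, M, hM, N, hN, P, hP, ?_, ?_, ?_⟩
  · intro x hx
    have h2 : a b x ∈ P := hbP ▸ Set.mem_image_of_mem _ hx
    rw [hm, hm, hcP _ h2, hdP _ h2, hinv]
  · intro x hx
    have h2 : a (b * g) x ∈ M := by
      have := Set.mem_image_of_mem (a (b * g)) hx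
      rwa [hbM] at this
    rw [mul_assoc, hm, hm, hcM _ h2, hinv, hdM _ hx, h1]
  · intro x hx
    have h2 : a (b * h) x ∈ N := by
      have := Set.mem_image_of_mem (a (b * h)) hx
      rwa [hbN] at this
    rw [mul_assoc, hm, hm, hcN _ h2, hinv, hdN _ hx]

/-- Property (3) of the algebraic criterion: there exists `r ≥ 1` such that for
all `g, h ∈ G` there exist `b, b₁, …, b_r ∈ B` such that for every `a ∈ A`
there is an `f ∈ ⟨b₁⟩⋯⟨b_r⟩` with `a^f b, a^f b g, a^f b h ∈ B`. -/
theorem property_three {G X : Type*} [Group G] [TopologicalSpace X]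
    [CompactSpace X] [T2Space X] [Infinite X]
    (a : G → X → X) (hact : IsActionByHomeos G X a)
    (hfaith : FaithfulAction G X a)
    (𝓘 : Set (Set X)) (hbasis : TopologicalSpace.IsTopologicalBasis 𝓘)
    (hne : ∀ I ∈ 𝓘, I.Nonempty) (hnd : ∀ I ∈ 𝓘, ¬ Dense I)
    (hCC : CondC 𝓘) (h2T : Cond2T a 𝓘) (h3T : Cond3T a 𝓘) (hL : CondL a 𝓘)
    (𝓐 : Finset (Set X)) (h𝓐sub : ↑𝓐 ⊆ 𝓘)
    (h𝓐cover : ∀ x : X, ∃ I ∈ 𝓐, x ∈ I)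
    (h𝓐sep : ∀ I ∈ 𝓐, ∀ J ∈ 𝓐, ∃ K ∈ 𝓐,
      closure K ∩ (closure I ∪ closure J) = (∅ : Set X))
    (A B : Set G)
    (hA : A = {g : G | ∃ I ∈ 𝓐, ∀ x ∈ I, a g x = x})
    (hB : B = {g : G | ∃ I ∈ 𝓘, ∀ x ∈ I, a g x = x}) :
    ∃ r : ℕ, 1 ≤ r ∧ ∀ g h : G, ∃ (b : G) (bs : Fin r → G),
      b ∈ B ∧ (∀ i : Fin r, bs i ∈ B) ∧
      ∀ a' ∈ A, ∃ ms : Fin r → ℤ, ∃ f : G,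
        f = (List.ofFn fun i : Fin r => bs i ^ ms i).prod ∧
        f * a' * f⁻¹ * b ∈ B ∧ f * a' * f⁻¹ * b * g ∈ B ∧
        f * a' * f⁻¹ * b * h ∈ B := by
  have hact' := hact
  obtain ⟨h1, hm, hcont⟩ := hact'
  have hinv : ∀ c : G, ∀ x, a c⁻¹ (a c x) = x := fun c x => by
    rw [← hm, inv_mul_cancel, h1]
  have h4 := four_factors a hact 𝓘 h3T hL B hB
  refine ⟨4 * 𝓐.card, ?_, ?_⟩
  · obtain ⟨I, hI, -⟩ := h𝓐cover (Classical.arbitrary X)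
    have := Finset.card_pos.2 ⟨I, hI⟩
    omega
  intro g h
  obtain ⟨b, M, hM, N, hN, P, hP, hbP, hbM, hbN⟩ := exists_b a hact 𝓘 h3T hL g h
  obtain ⟨m, hmM⟩ := hne M hM
  obtain ⟨n, hnN⟩ := hne N hN
  obtain ⟨p, hpP⟩ := hne P hP
  have hJ : ∃ J ∈ 𝓘, m ∈ J ∧ n ∈ J ∧ p ∈ J := by
    obtain ⟨x, hx⟩ := (Set.toFinite ({m, n, p} : Set X)).infinite_compl.nonempty
    obtain ⟨t, ht, -, hts⟩ := hbasis.exists_subset_of_mem_open hx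
      (Set.toFinite ({m, n, p} : Set X)).isClosed.isOpen_compl
    obtain ⟨J, hJ, htJ⟩ := hCC t ht
    exact ⟨J, hJ, htJ fun hh => hts hh (by simp), htJ fun hh => hts hh (by simp),
      htJ fun hh => hts hh (by simp)⟩
  obtain ⟨J, hJ, hmJ, hnJ, hpJ⟩ := hJ
  have hF : ∀ I : Set X, ∃ f : G, I ∈ 𝓘 → a f '' I = J := by
    intro I
    by_cases hI : I ∈ 𝓘
    · obtain ⟨K, hK⟩ := exists_tup2 a 𝓘 hbasis hnd h2T I hI
      obtain ⟨K', hK'⟩ := exists_tup2 a 𝓘 hbasis hnd h2T J hJ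
      obtain ⟨f, hf, -⟩ := h2T.2 I K J K' hK hK'
      exact ⟨f, fun _ => hf⟩
    · exact ⟨1, fun hh => absurd hh hI⟩
  choose F hF using hF
  obtain ⟨l, hl, hlB, hlF⟩ := word_family B h4 F 𝓐
  have hbs : List.ofFn (fun i : Fin (4 * 𝓐.card) => l.get (Fin.cast hl.symm i)) = l := by
    apply List.ext_get
    · simp [hl]
    · intro i hi hi'
      simp
  refine ⟨b, fun i => l.get (Fin.cast hl.symm i), ?_, ?_, ?_⟩
  · rw [hB]; exact ⟨P, hP, hbP⟩
  · intro i; exact hlB _ (List.get_mem _ _)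
  intro a' ha'
  rw [hA] at ha'
  obtain ⟨I, hI, hfix⟩ := ha'
  obtain ⟨ms, hms⟩ := wordIn_ofFn _ (fun i : Fin (4 * 𝓐.card) => l.get (Fin.cast hl.symm i))
    (F I) (by rw [hbs]; exact hlF I hI)
  have hFI := hF I (h𝓐sub hI)
  have hfixJ : ∀ x ∈ J, a (F I * a' * (F I)⁻¹) x = x := by
    intro x hx
    rw [← hFI] at hx
    obtain ⟨y, hy, rfl⟩ := hx
    rw [hm, hinv, hm, hfix y hy]
  have key : ∀ (c : G) (Q : Set X) (q : X), Q ∈ 𝓘 → q ∈ Q → q ∈ J →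
      (∀ x ∈ Q, a c x = x) → F I * a' * (F I)⁻¹ * c ∈ B := by
    intro c Q q hQ hqQ hqJ hc
    obtain ⟨t, ht, -, hts⟩ := hbasis.exists_subset_of_mem_open
      (show q ∈ Q ∩ J from ⟨hqQ, hqJ⟩) ((hbasis.isOpen hQ).inter (hbasis.isOpen hJ))
    rw [hB]
    refine ⟨t, ht, fun x hx => ?_⟩
    rw [hm, hc x (hts hx).1, hfixJ x (hts hx).2]
  refine ⟨ms, F I, hms, key b P p hP hpP hpJ hbP, ?_, ?_⟩
  · rw [mul_assoc _ b g]; exact key (b * g) M m hM hmM hmJ hbM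
  · rw [mul_assoc _ b h]; exact key (b * h) N n hN hnN hnJ hbN
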